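/- arXiv:1212.0209 — 5 statements merged into one kernel-verified Lean document; each statement's English description precedes it below -/
import Mathlib

section
/- Suppose M = {m₁, m₂, …, mₙ} is a set of positive integers with m₁ < m₂ < … < mₙ satisfying: (i) m_j − m_i ∈ M for all 2 ≤ i < j ≤ n, and (ii) M contains no multiple of n. Then μ(M) = 1/n. -/
open Filter Set Pointwise

/-- `countBelow S x` is the number of elements `n ∈ S` with `n ≤ x`. -/
noncomputable def countBelow (S : Set ℕ) (x : ℕ) : ℕ := (S ∩ Set.Iic x).ncard

/-- The upper asymptotic density `δ̄(S) = limsup_{x→∞} S(x)/x` of a set `S ⊆ ℕ`. -/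
noncomputable def upperDensity (S : Set ℕ) : ℝ :=
  Filter.limsup (fun x : ℕ => (countBelow S x : ℝ) / x) Filter.atTop

/-- `S` is an `M`-set: for all `a, b ∈ S`, the difference `a - b` does not lie in `M`. -/
def IsMSet (M S : Set ℕ) : Prop := ∀ a ∈ S, ∀ b ∈ S, a - b ∉ M

/-- Motzkin's quantity `μ(M)`: the supremum of the upper densities of all `M`-sets. -/
noncomputable def muM (M : Set ℕ) : ℝ :=
  sSup {x : ℝ | ∃ S : Set ℕ, IsMSet M S ∧ x = upperDensity S}

/-- If finitely many shifts `c i` have all their pairwise differences in `M`, then the translates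
of an `M`-set by the `c i` are disjoint, which bounds the counting function of the set. -/
theorem IsMSet.card_mul_countBelow_le {M S : Set ℕ} (hS : IsMSet M S) {n C : ℕ} (c : Fin n → ℕ)
    (hlt : ∀ p q, p < q → c p < c q) (hc : ∀ p q, p < q → c q - c p ∈ M) (hC : ∀ k, c k ≤ C)
    (x : ℕ) : n * countBelow S x ≤ x + 1 + C := by
  classical
  have hfin : (S ∩ Set.Iic x).Finite := (Set.finite_Iic x).inter_of_right S
  have key : ∀ p q : Fin n, p < q → ∀ s ∈ S, ∀ t ∈ S, c p + s ≠ c q + t := by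
    intro p q hpq s hs t ht h
    have h₁ := hlt p q hpq
    refine hS s hs t ht ?_
    have h₂ : s - t = c q - c p := by omega
    rw [h₂]
    exact hc p q hpq
  have hcard : (Finset.univ ×ˢ hfin.toFinset : Finset (Fin n × ℕ)).card
      ≤ (Finset.range (x + 1 + C)).card := by
    refine Finset.card_le_card_of_injOn (fun y => c y.1 + y.2) ?_ ?_
    · rintro ⟨k, s⟩ h
      simp at h
      have := hC k
      have := h.2
      simp
      omega
    · rintro ⟨p, s⟩ h ⟨q, t⟩ h' he
      simp at h h' he
      rcases lt_trichotomy p q with hpq | rfl | hpq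
      · exact absurd he (key p q hpq s h.1 t h'.1)
      · simpa using he
      · exact absurd he.symm (key q p hpq t h'.1 s h.1)
  rw [Finset.card_product, Finset.card_univ, Fintype.card_fin, Finset.card_range,
    ← Set.ncard_eq_toFinset_card _ hfin] at hcard
  exact hcard

theorem tendsto_one_div_add_const_div (n : ℕ) (C : ℝ) :
    Tendsto (fun x : ℕ => 1 / (n : ℝ) + C / x) atTop (nhds (1 / (n : ℝ))) := by
  simpa using (tendsto_const_nhds (x := 1 / (n : ℝ))).add (tendsto_const_div_atTop_nhds_zero_nat C)

theorem countBelow_div_le {S : Set ℕ} {n C : ℕ} (hn : 0 < n)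
    (h : ∀ x, n * countBelow S x ≤ x + C) :
    ∀ᶠ x : ℕ in atTop, (countBelow S x : ℝ) / x ≤ 1 / (n : ℝ) + (C : ℝ) / x := by
  filter_upwards [eventually_gt_atTop 0] with x hx
  have hx' : (0 : ℝ) < x := by exact_mod_cast hx
  have hn' : (1 : ℝ) ≤ n := by exact_mod_cast hn
  have hh : (n : ℝ) * countBelow S x ≤ x + C := by exact_mod_cast h x
  have hC : (0 : ℝ) ≤ C := C.cast_nonneg
  have h₂ : 1 / (n : ℝ) + (C : ℝ) / x = (x + n * C) / n / x := by field_simp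
  rw [h₂]
  gcongr
  rw [le_div_iff₀ (by linarith)]
  nlinarith

theorem isCoboundedUnder_countBelow_div (S : Set ℕ) :
    IsCoboundedUnder (· ≤ ·) atTop (fun x : ℕ => (countBelow S x : ℝ) / x) :=
  (isBoundedUnder_of ⟨0, fun _ => by positivity⟩ :
    IsBoundedUnder (· ≥ ·) atTop (fun x : ℕ => (countBelow S x : ℝ) / x)).isCoboundedUnder_le

theorem upperDensity_le_one_div {S : Set ℕ} {n C : ℕ} (hn : 0 < n)
    (h : ∀ x, n * countBelow S x ≤ x + C) : upperDensity S ≤ 1 / (n : ℝ) := by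
  have ht := tendsto_one_div_add_const_div n C
  rw [← ht.limsup_eq]
  exact limsup_le_limsup (countBelow_div_le hn h) (isCoboundedUnder_countBelow_div S)
    ht.isBoundedUnder_le

theorem le_mul_countBelow_multiples {n : ℕ} (hn : 0 < n) (x : ℕ) :
    x ≤ n * countBelow {a | n ∣ a} x := by
  have hfin : ({a | n ∣ a} ∩ Set.Iic x).Finite := (Set.finite_Iic x).inter_of_right _
  have hcard : (Finset.range (x / n + 1)).card ≤ hfin.toFinset.card := by
    refine Finset.card_le_card_of_injOn (fun k => n * k) ?_ ?_
    · intro k hk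
      have hk' : k ≤ x / n := by simpa [Nat.lt_succ_iff] using hk
      simpa using (Nat.mul_le_mul_left n hk').trans (Nat.mul_div_le x n)
    · intro a _ b _ h
      exact Nat.eq_of_mul_eq_mul_left hn h
  rw [Finset.card_range, ← Set.ncard_eq_toFinset_card _ hfin] at hcard
  exact (Nat.lt_mul_div_succ x hn).le.trans (Nat.mul_le_mul_left n hcard)

theorem one_div_le_upperDensity {S : Set ℕ} {n C : ℕ} (hn : 0 < n)
    (hle : ∀ x, n * countBelow S x ≤ x + C) (hge : ∀ x, x ≤ n * countBelow S x) :
    1 / (n : ℝ) ≤ upperDensity S := by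
  have hbdd : IsBoundedUnder (· ≤ ·) atTop (fun x : ℕ => (countBelow S x : ℝ) / x) :=
    (tendsto_one_div_add_const_div n C).isBoundedUnder_le.mono_le (countBelow_div_le hn hle)
  refine le_limsup_of_frequently_le (Eventually.frequently ?_) hbdd
  filter_upwards [eventually_gt_atTop 0] with x hx
  have hx' : (0 : ℝ) < x := by exact_mod_cast hx
  have hn' : (0 : ℝ) < n := by exact_mod_cast hn
  rw [div_le_div_iff₀ hn' hx', one_mul, mul_comm]
  exact_mod_cast hge x

/-- Theorem 2: If `M = {m₁ < m₂ < ⋯ < mₙ}` satisfies (i) `m_j - m_i ∈ M` for all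
`2 ≤ i < j ≤ n` and (ii) `M` contains no multiple of `n`, then `μ(M) = 1/n`. -/
theorem stmt2 (n : ℕ) (hn : 0 < n) (m : Fin n → ℕ)
    (hpos : ∀ k, 0 < m k) (hmono : StrictMono m)
    (hdiff : ∀ p q : Fin n, 0 < (p : ℕ) → p < q → m q - m p ∈ Set.range m)
    (hnodiv : ∀ v ∈ Set.range m, ¬ n ∣ v) :
    muM (Set.range m) = 1 / (n : ℝ) := by
  obtain ⟨C, hC⟩ : ∃ C, ∀ k, m k ≤ C :=
    ⟨∑ k, m k, fun k => Finset.single_le_sum (fun _ _ => Nat.zero_le _) (Finset.mem_univ k)⟩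
  have hcount : ∀ S, IsMSet (Set.range m) S → ∀ x, n * countBelow S x ≤ x + (1 + C) := by
    intro S hS x
    rw [← add_assoc]
    refine hS.card_mul_countBelow_le (fun k => if (k : ℕ) = 0 then 0 else m k) ?_ ?_ ?_ x
    · intro p q hpq
      have hq : (q : ℕ) ≠ 0 := by have : (p : ℕ) < q := hpq; omega
      by_cases hp : (p : ℕ) = 0
      · simpa [hp, hq] using hpos q
      · simpa [hp, hq] using hmono hpq
    · intro p q hpq
      have hq : (q : ℕ) ≠ 0 := by have : (p : ℕ) < q := hpq; omega
      by_cases hp : (p : ℕ) = 0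
      · simp [hp, hq]
      · simpa only [hp, hq, if_false] using hdiff p q (Nat.pos_of_ne_zero hp) hpq
    · intro k
      have := hC k
      split_ifs <;> omega
  have hmult : IsMSet (Set.range m) {a | n ∣ a} := fun a ha b hb hab =>
    hnodiv _ hab (Nat.dvd_sub ha hb)
  have hub : ∀ y ∈ {y : ℝ | ∃ S : Set ℕ, IsMSet (Set.range m) S ∧ y = upperDensity S},
      y ≤ 1 / (n : ℝ) := by
    rintro _ ⟨S, hS, rfl⟩
    exact upperDensity_le_one_div hn (hcount S hS)
  refine le_antisymm (csSup_le ⟨_, _, hmult, rfl⟩ hub) ?_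
  exact (one_div_le_upperDensity hn (hcount _ hmult) (le_mul_countBelow_multiples hn)).trans
    (le_csSup ⟨_, hub⟩ ⟨_, hmult, rfl⟩)
end

section
/- Let i, j, n be positive integers with gcd(i, j) = 1, and let M = {i + kj : 0 ≤ k ≤ n−1} ∪ {j}. Let r be the residue of i + nj modulo n+1 with 0 ≤ r ≤ n. If gcd(r, i + nj) = 1, then μ(M) ≥ (i + nj − r)/((n+1)(i + nj)). -/
open Filter Set Pointwise

theorem countBelow_div_nonneg (S : Set ℕ) (x : ℕ) : (0 : ℝ) ≤ (countBelow S x : ℝ) / x := by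
  positivity

theorem countBelow_div_le_two (S : Set ℕ) (x : ℕ) : (countBelow S x : ℝ) / x ≤ 2 := by
  rcases Nat.eq_zero_or_pos x with rfl | hx
  · simp
  have h : countBelow S x ≤ x + 1 :=
    (ncard_le_ncard inter_subset_right (finite_Iic x)).trans_eq (by
      rw [← Finset.coe_Iic, ncard_coe_finset, Nat.card_Iic])
  have hx' : (1 : ℝ) ≤ x := by exact_mod_cast hx
  have h' : (countBelow S x : ℝ) ≤ x + 1 := by exact_mod_cast h
  rw [div_le_iff₀ (by positivity)]
  linarith

theorem upperDensity_le_two (S : Set ℕ) : upperDensity S ≤ 2 :=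
  limsup_le_of_le
    (IsBoundedUnder.isCoboundedUnder_le (isBoundedUnder_of ⟨0, countBelow_div_nonneg S⟩))
    (.of_forall (countBelow_div_le_two S))

theorem upperDensity_le_muM {M S : Set ℕ} (hS : IsMSet M S) : upperDensity S ≤ muM M :=
  le_csSup ⟨2, by rintro x ⟨T, -, rfl⟩; exact upperDensity_le_two T⟩ ⟨S, hS, rfl⟩

/-- A set containing all translates by multiples of `m` of `q` distinct residues `f a < m` has upper
density at least `q / m`. -/
theorem div_le_upperDensity {S : Set ℕ} {m q : ℕ} (hm : 0 < m) (f : ℕ → ℕ)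
    (hf : ∀ a, f a < m) (hinj : Set.InjOn f (Set.Iio q))
    (hS : ∀ u, ∀ a < q, u * m + f a ∈ S) : (q : ℝ) / m ≤ upperDensity S := by
  refine le_limsup_of_frequently_le ?_ (isBoundedUnder_of ⟨2, countBelow_div_le_two S⟩)
  rw [frequently_atTop]
  intro N
  refine ⟨m * (N + 1), by nlinarith, ?_⟩
  have hcount : (N + 1) * q ≤ countBelow S (m * (N + 1)) := by
    have hcard : ((fun p : ℕ × ℕ => p.1 * m + f p.2) ''
        ((Finset.range (N + 1) ×ˢ Finset.range q : Finset (ℕ × ℕ)) : Set (ℕ × ℕ))).ncard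
          = (N + 1) * q := by
      rw [InjOn.ncard_image, ncard_coe_finset, Finset.card_product, Finset.card_range,
        Finset.card_range]
      rintro ⟨u, a⟩ ha ⟨v, b⟩ hb h
      simp only [Finset.coe_product, Finset.coe_range, mem_prod, mem_Iio] at ha hb h
      have hmod := congrArg (· % m) h
      have hdiv := congrArg (· / m) h
      simp only [Nat.mul_add_mod', Nat.mod_eq_of_lt (hf _)] at hmod
      simp only [mul_comm _ m, Nat.mul_add_div hm, Nat.div_eq_of_lt (hf _), add_zero] at hdiv
      exact Prod.ext hdiv (hinj ha.2 hb.2 hmod)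
    rw [← hcard]
    refine ncard_le_ncard ?_ ((finite_Iic _).inter_of_right S)
    rintro _ ⟨⟨u, a⟩, h, rfl⟩
    simp only [Finset.coe_product, Finset.coe_range, mem_prod, mem_Iio] at h
    refine ⟨hS u a h.2, ?_⟩
    have := hf a
    simp only [mem_Iic]
    nlinarith [h.1]
  have hm' : (0 : ℝ) < m := by exact_mod_cast hm
  have hcount' : ((N : ℝ) + 1) * q ≤ countBelow S (m * (N + 1)) := by exact_mod_cast hcount
  push_cast
  rw [div_le_div_iff₀ hm' (by positivity)]
  nlinarith

/-- Modulo `m` with `j` coprime to `m`, the multiples `a (n+1) j`, `a < q`, of step `(n+1) j` have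
no two elements differing by `t j` with `0 < t ≤ n`, provided `q (n+1) ≤ m`. -/
theorem not_modEq_step {m n j q a b t : ℕ} (hcop : Nat.gcd m j = 1) (hq : q * (n + 1) ≤ m)
    (ha : a < q) (hb : b < q) (ht : 0 < t) (htn : t ≤ n) :
    ¬ a * (n + 1) * j + t * j ≡ b * (n + 1) * j [MOD m] := by
  rw [← add_mul]
  intro h
  have ha' : (a + 1) * (n + 1) ≤ q * (n + 1) := Nat.mul_le_mul_right _ ha
  have hb' : (b + 1) * (n + 1) ≤ q * (n + 1) := Nat.mul_le_mul_right _ hb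
  have h₁ := (Nat.ModEq.cancel_right_of_coprime hcop h).eq_of_lt_of_lt
    (by linarith) (by linarith)
  have h₂ := congrArg (· % (n + 1)) h₁
  simp only [Nat.mul_add_mod', Nat.mul_mod_left, Nat.mod_eq_of_lt (Nat.lt_succ_of_le htn)] at h₂
  omega

/-- Theorem 3 (first part): For `M = {i + kj : 0 ≤ k ≤ n-1} ∪ {j}` with `gcd(i,j) = 1`,
if `r` is the residue of `i + nj` mod `n+1` and `gcd(r, i + nj) = 1`, then
`μ(M) ≥ (i + nj - r)/((n+1)(i + nj))`. -/
theorem stmt6 (i j n : ℕ) (hi : 0 < i) (hj : 0 < j) (hn : 0 < n)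
    (hgcd : Nat.gcd i j = 1)
    (M : Set ℕ) (hM : M = {m | ∃ k < n, m = i + k * j} ∪ {j})
    (r : ℕ) (hr : r = (i + n * j) % (n + 1))
    (hrcop : Nat.gcd r (i + n * j) = 1) :
    ((i : ℝ) + n * j - r) / (((n : ℝ) + 1) * ((i : ℝ) + n * j)) ≤ muM M := by
  obtain ⟨m, hm⟩ : ∃ m, m = i + n * j := ⟨_, rfl⟩
  have hm0 : 0 < m := by omega
  have hcop : Nat.gcd m j = 1 := by rw [hm, Nat.gcd_add_mul_right_left, hgcd]
  obtain ⟨q, hqdef⟩ : ∃ q, q = m / (n + 1) := ⟨_, rfl⟩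
  have hqr : (n + 1) * q + r = m := by rw [hqdef, hr, ← hm, Nat.div_add_mod]
  have hq : q * (n + 1) ≤ m := by linarith
  have hS : IsMSet M {s | ∃ a < q, s ≡ a * (n + 1) * j [MOD m]} := by
    rintro s ⟨a, ha, hsa⟩ t ⟨b, hb, htb⟩ hst
    rw [hM] at hst
    rcases hst with ⟨k, hk, hd⟩ | hd
    · obtain ⟨d, rfl⟩ := Nat.exists_eq_add_of_lt hk
      refine not_modEq_step (t := d + 1) hcop hq ha hb (by omega) (by omega) ?_
      have hs : s + (d + 1) * j = t + m := by
        have : s = t + (i + k * j) := by omega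
        rw [this, hm]; ring
      calc _ ≡ s + (d + 1) * j [MOD m] := hsa.symm.add_right _
        _ ≡ t [MOD m] := by rw [hs]; exact Nat.add_mod_right t m
        _ ≡ _ [MOD m] := htb
    · have hs : s = t + 1 * j := by
        have : s - t = j := hd
        omega
      refine not_modEq_step (t := 1) hcop hq hb ha one_pos hn ?_
      exact (htb.symm.add_right _).trans (hs ▸ hsa)
  refine le_trans (le_of_eq ?_) ((div_le_upperDensity (q := q) hm0 (fun a => a * (n + 1) * j % m)
    (fun a => Nat.mod_lt _ hm0) ?_ ?_).trans (upperDensity_le_muM hS))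
  · have hmR : (m : ℝ) = i + n * j := by exact_mod_cast hm
    have hqR : ((n : ℝ) + 1) * q + r = m := by exact_mod_cast hqr
    have : (0 : ℝ) < m := by exact_mod_cast hm0
    rw [← hmR, ← hqR, add_sub_cancel_right, hqR, mul_div_mul_left _ _ (by positivity)]
  · intro a ha b hb h
    have hlt : ∀ c < q, c * (n + 1) < m := fun c hc =>
      (Nat.mul_lt_mul_of_pos_right hc n.succ_pos).trans_le hq
    exact Nat.eq_of_mul_eq_mul_right n.succ_pos
      ((Nat.ModEq.cancel_right_of_coprime hcop h).eq_of_lt_of_lt (hlt a ha) (hlt b hb))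
  · intro u a ha
    exact ⟨a, ha, by simp [Nat.ModEq]⟩
end

section
/- Let i, j, n be positive integers with n ≥ 1 and gcd(i, j) = 1, and let M = {i + k₁j : 0 ≤ k₁ ≤ n−1} ∪ {k₂j : 1 ≤ k₂ ≤ n}. If i + nj ≡ 1 (mod n+1), then μ(M) = (i + nj − 1)/((n+1)(i + nj)). -/
open Filter Set Pointwise

open Topology

open Classical in
lemma countBelow_eq_count (S : Set ℕ) (x : ℕ) :
    countBelow S x = Nat.count (· ∈ S) (x + 1) := by
  rw [Nat.count_eq_card_filter_range, countBelow, ← Set.ncard_coe_finset]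
  congr 1
  ext m
  simp [and_comm]

open Classical in
lemma count_mul_le {S : Set ℕ} {N q : ℕ}
    (h : ∀ a, Nat.count (fun k => a + k ∈ S) N ≤ q) (k : ℕ) :
    Nat.count (· ∈ S) (k * N) ≤ k * q := by
  induction k with
  | zero => simp
  | succ k ih =>
    rw [add_mul, one_mul, Nat.count_add, add_mul, one_mul]
    exact add_le_add ih (h _)

open Classical in
lemma mul_le_count {S : Set ℕ} {N q : ℕ}
    (h : ∀ a, q ≤ Nat.count (fun k => a + k ∈ S) N) (k : ℕ) :
    k * q ≤ Nat.count (· ∈ S) (k * N) := by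
  induction k with
  | zero => simp
  | succ k ih =>
    rw [add_mul, one_mul, add_mul k 1 N, one_mul, Nat.count_add]
    exact add_le_add ih (h _)

lemma tendsto_mul_add_div (c d : ℝ) :
    Tendsto (fun x : ℕ => (c * x + d) / x) atTop (𝓝 c) := by
  have h : Tendsto (fun x : ℕ => c + d / (x : ℝ)) atTop (𝓝 (c + 0)) :=
    tendsto_const_nhds.add (tendsto_const_div_atTop_nhds_zero_nat d)
  rw [add_zero] at h
  refine h.congr' ?_
  filter_upwards [eventually_gt_atTop 0] with x hx
  have : (x : ℝ) ≠ 0 := by positivity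
  field_simp

open Classical in
/-- If every interval of length `N` contains at most `q` elements of `S`, then the upper density
of `S` is at most `q / N`. -/
lemma upperDensity_le {S : Set ℕ} {N q : ℕ} (hN : 0 < N)
    (h : ∀ a, Nat.count (fun k => a + k ∈ S) N ≤ q) :
    upperDensity S ≤ (q : ℝ) / N := by
  have hN' : (0 : ℝ) < N := by exact_mod_cast hN
  have hlim := tendsto_mul_add_div ((q : ℝ) / N) (2 * q)
  rw [← hlim.limsup_eq]
  refine limsup_le_limsup (Eventually.of_forall fun x => ?_) ?_ hlim.isBoundedUnder_le
  · have h1 : countBelow S x ≤ (x / N + 2) * q := by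
      rw [countBelow_eq_count]
      refine le_trans (Nat.count_monotone _ ?_) (count_mul_le h _)
      have := Nat.lt_div_mul_add (a := x) hN
      nlinarith
    have h2 : ((x / N : ℕ) : ℝ) ≤ (x : ℝ) / N := Nat.cast_div_le
    have h3 : (countBelow S x : ℝ) ≤ ((x / N : ℕ) + 2) * q := by exact_mod_cast h1
    have h4 : (countBelow S x : ℝ) ≤ (q : ℝ) / N * x + 2 * q := by
      calc (countBelow S x : ℝ) ≤ ((x / N : ℕ) + 2) * q := h3
        _ ≤ ((x : ℝ) / N + 2) * q := by gcongr
        _ = _ := by ring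
    dsimp only
    gcongr
  · exact IsBoundedUnder.isCoboundedUnder_le
      (isBoundedUnder_of ⟨0, fun x => by positivity⟩)

open Classical in
/-- If every interval of length `N` contains at least `q` elements of `S`, then the upper density
of `S` is at least `q / N`. -/
lemma le_upperDensity {S : Set ℕ} {N q : ℕ} (hN : 0 < N)
    (h : ∀ a, q ≤ Nat.count (fun k => a + k ∈ S) N) :
    (q : ℝ) / N ≤ upperDensity S := by
  have hN' : (0 : ℝ) < N := by exact_mod_cast hN
  have hlim := tendsto_mul_add_div ((q : ℝ) / N) (-q)
  rw [← hlim.limsup_eq]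
  refine limsup_le_limsup (Eventually.of_forall fun x => ?_)
    hlim.isBoundedUnder_ge.isCoboundedUnder_le ?_
  · have h1 : x / N * q ≤ countBelow S x := by
      rw [countBelow_eq_count]
      exact (mul_le_count h _).trans
        (Nat.count_monotone _ ((Nat.div_mul_le_self x N).trans (Nat.le_succ x)))
    have h2 : (x : ℝ) / N ≤ (x / N : ℕ) + 1 := by
      rw [div_le_iff₀ hN']
      have := (Nat.lt_div_mul_add (a := x) hN).le
      have : (x : ℝ) ≤ (x / N : ℕ) * N + N := by exact_mod_cast this
      linarith
    have h3 : ((x / N : ℕ) : ℝ) * q ≤ countBelow S x := by exact_mod_cast h1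
    have h4 : (q : ℝ) / N * x + -q ≤ countBelow S x := by
      calc (q : ℝ) / N * x + -q = ((x : ℝ) / N - 1) * q := by ring
        _ ≤ (x / N : ℕ) * q := by gcongr; linarith
        _ ≤ _ := h3
    dsimp only
    gcongr
  · refine isBoundedUnder_of ⟨2, fun x => ?_⟩
    rcases Nat.eq_zero_or_pos x with rfl | hx
    · simp
    · have h1 : countBelow S x ≤ 2 * x := by
        rw [countBelow_eq_count]
        exact (Nat.count_le _).trans (by omega)
      rw [div_le_iff₀ (by positivity)]
      exact_mod_cast h1

/-- The set `{i, i + j, …, i + (n - 1) j} ∪ {j, 2 j, …, n j}`. -/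
def progressionUnion (i j n : ℕ) : Set ℕ :=
  {m | ∃ k < n, m = i + k * j} ∪ {m | ∃ k, 1 ≤ k ∧ k ≤ n ∧ m = k * j}

/-- Two elements at distance less than `i + n j` of an `M`-set cannot differ by `d j` modulo
`i + n j` when `1 ≤ d ≤ n`. -/
lemma IsMSet.not_modEq {i j n : ℕ} (hi : 0 < i) (hj : 0 < j) {S : Set ℕ}
    (hS : IsMSet (progressionUnion i j n) S) {x y d : ℕ} (hx : x ∈ S) (hy : y ∈ S)
    (hxy : |(y : ℤ) - x| < (i + n * j : ℕ)) (hd : 1 ≤ d) (hdn : d ≤ n) :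
    ¬ ((i + n * j : ℕ) : ℤ) ∣ (y : ℤ) - x - d * j := by
  rintro ⟨c, hc⟩
  obtain ⟨e, rfl⟩ := Nat.exists_eq_add_of_le hdn
  rw [abs_lt] at hxy
  have hdj : 0 < d * j := Nat.mul_pos hd hj
  have hN : i + (d + e) * j = i + d * j + e * j := by ring
  rw [hN] at hc hxy
  push_cast at hc hxy
  have hdj' : (0 : ℤ) < d * j := by exact_mod_cast hdj
  have hej' : (0 : ℤ) ≤ e * j := by positivity
  have hi' : (0 : ℤ) < i := by exact_mod_cast hi
  have hc1 : c < 1 := by nlinarith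
  have hc2 : -2 < c := by nlinarith
  obtain rfl | rfl : c = 0 ∨ c = -1 := by omega
  · refine hS y hy x hx (Or.inr ⟨d, hd, hdn, ?_⟩)
    have : (y : ℤ) = x + (d * j : ℕ) := by push_cast; linarith
    omega
  · refine hS x hx y hy (Or.inl ⟨e, by omega, ?_⟩)
    have : (x : ℤ) = y + (i + e * j : ℕ) := by push_cast; linarith
    omega

open Classical in
lemma IsMSet.count_mul_le {i j n : ℕ} (hi : 0 < i) (hj : 0 < j) {S : Set ℕ}
    (hS : IsMSet (progressionUnion i j n) S) (a : ℕ) :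
    Nat.count (fun k => a + k ∈ S) (i + n * j) * (n + 1) ≤ i + n * j := by
  have : NeZero (i + n * j) := ⟨by omega⟩
  rw [Nat.count_eq_card_filter_range]
  set T := (Finset.range (i + n * j)).filter (fun k => a + k ∈ S) with hT
  have key : ∀ x ∈ T, ∀ y ∈ T, ∀ k l : ℕ, k ≤ n → l ≤ k →
      ((x + k * j : ℕ) : ZMod (i + n * j)) = (y + l * j : ℕ) → x = y ∧ k = l := by
    intro x hx y hy k l hk hlk hxy
    rw [hT, Finset.mem_filter, Finset.mem_range] at hx hy
    obtain ⟨d, rfl⟩ := Nat.exists_eq_add_of_le hlk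
    have hdvd : ((i + n * j : ℕ) : ℤ) ∣ (y : ℤ) - x - d * j := by
      rw [ZMod.natCast_eq_natCast_iff, Nat.modEq_iff_dvd] at hxy
      convert hxy using 1
      push_cast
      ring
    have habs : |(y : ℤ) - x| < (i + n * j : ℕ) := by
      rw [abs_lt]
      omega
    rcases Nat.eq_zero_or_pos d with rfl | hd
    · have := Int.eq_zero_of_abs_lt_dvd (by simpa using hdvd) habs
      omega
    · refine absurd ?_ (hS.not_modEq (d := d) hi hj hx.2 hy.2 ?_ hd (by omega))
      · push_cast at hdvd ⊢
        simpa using hdvd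
      · simpa using habs
  have hcard := Finset.card_le_card_of_injOn (s := T ×ˢ Finset.range (n + 1))
    (t := (Finset.univ : Finset (ZMod (i + n * j))))
    (fun p => ((p.1 + p.2 * j : ℕ) : ZMod (i + n * j))) (fun _ _ => Finset.mem_univ _) (by
      rintro ⟨x, k⟩ hx ⟨y, l⟩ hy hxy
      simp only [Finset.coe_product, Set.mem_prod, Finset.mem_coe, Finset.mem_range] at hx hy
      dsimp only at hxy
      rcases le_total l k with hlk | hkl
      · obtain ⟨rfl, rfl⟩ := key x hx.1 y hy.1 k l (by omega) hlk hxy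
        rfl
      · obtain ⟨rfl, rfl⟩ := key y hy.1 x hx.1 l k (by omega) hkl hxy.symm
        rfl)
  rwa [Finset.card_product, Finset.card_range, Finset.card_univ, ZMod.card] at hcard

/-- The integers congruent modulo `i + n j` to `t (n + 1) j` for some `t < q`. -/
def spacedSet (i j n q : ℕ) : Set ℕ :=
  {m | ∃ t < q, (m : ZMod (i + n * j)) = ((t * (n + 1) : ℕ) : ZMod (i + n * j)) * j}

lemma isUnit_natCast_zmod {i j : ℕ} (n : ℕ) (hgcd : Nat.gcd i j = 1) :
    IsUnit (j : ZMod (i + n * j)) := by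
  rw [ZMod.isUnit_iff_coprime]
  have : Nat.Coprime i j := hgcd
  simpa using this.symm

lemma natCast_mul_right_cancel {i j n x y : ℕ} (hgcd : Nat.gcd i j = 1)
    (h : (x : ZMod (i + n * j)) * j = y * j) :
    ((i + n * j : ℕ) : ℤ) ∣ (y : ℤ) - x := by
  have h' := (isUnit_natCast_zmod n hgcd).mul_right_cancel h
  rwa [ZMod.natCast_eq_natCast_iff, Nat.modEq_iff_dvd] at h'

lemma spaced_not_dvd {N n q t u d : ℕ} (hN : q * (n + 1) ≤ N) (ht : t < q) (hu : u < q)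
    (hd : 1 ≤ d) (hdn : d ≤ n) :
    ¬ (N : ℤ) ∣ ((t * (n + 1) : ℕ) : ℤ) - (u * (n + 1) + d : ℕ) := by
  intro h
  have h1 : (t + 1) * (n + 1) ≤ q * (n + 1) := Nat.mul_le_mul_right _ ht
  have h2 : (u + 1) * (n + 1) ≤ q * (n + 1) := Nat.mul_le_mul_right _ hu
  have h0 := Int.eq_zero_of_abs_lt_dvd h (by rw [abs_lt]; constructor <;> push_cast <;> nlinarith)
  have h3 : t * (n + 1) = u * (n + 1) + d := by omega
  have h4 : (n + 1) ∣ d := (Nat.dvd_add_right (Dvd.intro_left u rfl)).1 (h3 ▸ Dvd.intro_left t rfl)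
  exact absurd (Nat.le_of_dvd hd h4) (by omega)

lemma isMSet_spacedSet {i j n q : ℕ} (hi : 0 < i) (hj : 0 < j) (hgcd : Nat.gcd i j = 1)
    (hq : q * (n + 1) ≤ i + n * j) :
    IsMSet (progressionUnion i j n) (spacedSet i j n q) := by
  rintro a ⟨t, ht, hat⟩ b ⟨u, hu, hbu⟩ (⟨k, hk, hm⟩ | ⟨k, hk, hkn, hm⟩)
  · obtain ⟨e, rfl⟩ := Nat.exists_eq_add_of_lt hk
    have hab : a + (e + 1) * j = b + (i + (k + e + 1) * j) := by
      have : (k + e + 1) * j = k * j + (e + 1) * j := by ring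
      omega
    have hab' := congrArg (Nat.cast : ℕ → ZMod (i + (k + e + 1) * j)) hab
    rw [Nat.cast_add, Nat.cast_add b, ZMod.natCast_self, add_zero, hat, hbu, Nat.cast_mul (e + 1),
      ← add_mul, ← Nat.cast_add] at hab'
    exact spaced_not_dvd hq hu ht (by omega) (by omega) (natCast_mul_right_cancel hgcd hab')
  · have hab : b + k * j = a := by
      have := Nat.mul_pos hk hj
      omega
    have hab' := congrArg (Nat.cast : ℕ → ZMod (i + n * j)) hab
    rw [Nat.cast_add, hat, hbu, Nat.cast_mul k, ← add_mul, ← Nat.cast_add] at hab'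
    exact spaced_not_dvd hq ht hu hk hkn (natCast_mul_right_cancel hgcd hab')

open Classical in
lemma le_count_spacedSet {i j n q : ℕ} (hi : 0 < i) (hgcd : Nat.gcd i j = 1)
    (hq : q * (n + 1) ≤ i + n * j) (a : ℕ) :
    q ≤ Nat.count (fun k => a + k ∈ spacedSet i j n q) (i + n * j) := by
  have : NeZero (i + n * j) := ⟨by omega⟩
  rw [Nat.count_eq_card_filter_range]
  conv_lhs => rw [← Finset.card_range q]
  refine Finset.card_le_card_of_injOn
    (fun t => (((t * (n + 1) : ℕ) : ZMod (i + n * j)) * j - a).val) ?_ ?_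
  · intro t ht
    rw [Finset.mem_coe, Finset.mem_filter, Finset.mem_range]
    refine ⟨ZMod.val_lt _, t, by simpa using ht, ?_⟩
    rw [Nat.cast_add, ZMod.natCast_zmod_val]
    ring
  · intro t ht u hu htu
    rw [Finset.mem_coe, Finset.mem_range] at ht hu
    have h := natCast_mul_right_cancel hgcd (sub_left_injective (ZMod.val_injective _ htu))
    have h1 : (t + 1) * (n + 1) ≤ q * (n + 1) := Nat.mul_le_mul_right _ ht
    have h2 : (u + 1) * (n + 1) ≤ q * (n + 1) := Nat.mul_le_mul_right _ hu
    have h0 := Int.eq_zero_of_abs_lt_dvd h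
      (by rw [abs_lt]; constructor <;> push_cast <;> nlinarith)
    have h3 : t * (n + 1) = u * (n + 1) := by omega
    exact Nat.eq_of_mul_eq_mul_right n.succ_pos h3

/-- For coprime `i` and `j`, `μ(M) = ⌊(i + n j) / (n + 1)⌋ / (i + n j)`. -/
theorem muM_progressionUnion {i j n : ℕ} (hi : 0 < i) (hj : 0 < j) (hgcd : Nat.gcd i j = 1) :
    muM (progressionUnion i j n) = (((i + n * j) / (n + 1) : ℕ) : ℝ) / (i + n * j : ℕ) := by
  classical
  have hN : 0 < i + n * j := by omega
  have hq : (i + n * j) / (n + 1) * (n + 1) ≤ i + n * j := Nat.div_mul_le_self _ _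
  have hle : ∀ S, IsMSet (progressionUnion i j n) S →
      upperDensity S ≤ (((i + n * j) / (n + 1) : ℕ) : ℝ) / (i + n * j : ℕ) := fun S hS =>
    upperDensity_le hN fun a => (Nat.le_div_iff_mul_le n.succ_pos).2 (hS.count_mul_le hi hj a)
  refine IsGreatest.csSup_eq ⟨⟨_, isMSet_spacedSet hi hj hgcd hq, le_antisymm ?_ ?_⟩, ?_⟩
  · exact le_upperDensity hN (le_count_spacedSet hi hgcd hq)
  · exact hle _ (isMSet_spacedSet hi hj hgcd hq)
  · rintro _ ⟨S, hS, rfl⟩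
    exact hle S hS

/-- Theorem 4: For `M = {i + k₁j : 0 ≤ k₁ ≤ n-1} ∪ {k₂j : 1 ≤ k₂ ≤ n}` with
`gcd(i,j) = 1` and `i + nj ≡ 1 (mod n+1)`, we have
`μ(M) = (i + nj - 1)/((n+1)(i + nj))`. -/
theorem stmt10 (i j n : ℕ) (hi : 0 < i) (hj : 0 < j) (hn : 0 < n)
    (hgcd : Nat.gcd i j = 1)
    (M : Set ℕ)
    (hM : M = {m | ∃ k < n, m = i + k * j} ∪ {m | ∃ k, 1 ≤ k ∧ k ≤ n ∧ m = k * j})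
    (hres : (i + n * j) % (n + 1) = 1) :
    muM M = ((i : ℝ) + n * j - 1) / (((n : ℝ) + 1) * ((i : ℝ) + n * j)) := by
  subst hM
  have h := muM_progressionUnion (n := n) hi hj hgcd
  have hdiv := Nat.div_add_mod (i + n * j) (n + 1)
  rw [hres] at hdiv
  have hdiv' : ((n : ℝ) + 1) * ((i + n * j) / (n + 1) : ℕ) + 1 = i + n * j := by
    exact_mod_cast hdiv
  have hN : (0 : ℝ) < i + n * j := by positivity
  refine h.trans ?_
  rw [← hdiv', add_sub_cancel_right, hdiv', mul_div_mul_left _ _ (by positivity)]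
  push_cast
  rfl
end

section
/- Let M be a set of positive integers with 1 ∈ M and q ∈ M, where q > 1 is even. Then μ(M) ≤ q/(2(q+1)). -/
open Filter Set Pointwise

/-- The independence number of the odd cycle on `n, n + 1, …, n + q` bounds the number of elements
of a set avoiding the differences `1` and `q` in a window of `q + 1` consecutive integers. -/
lemma two_mul_sum_indicator_le {S : Set ℕ} {q : ℕ} (hqe : Even q)
    (h1 : ∀ n ∈ S, n + 1 ∉ S) (hq : ∀ n ∈ S, n + q ∉ S) (n : ℕ) :
    2 * ∑ i ∈ Finset.range (q + 1), S.indicator (1 : ℕ → ℕ) (n + i) ≤ q := by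
  classical
  have hone : ∀ m, S.indicator (1 : ℕ → ℕ) m + S.indicator (1 : ℕ → ℕ) (m + 1) ≤ 1 := by
    intro m
    have := h1 m
    by_cases hm : m ∈ S <;> by_cases hm' : m + 1 ∈ S <;> simp_all
  have hends : S.indicator (1 : ℕ → ℕ) n + S.indicator (1 : ℕ → ℕ) (n + q) ≤ 1 := by
    have := hq n
    by_cases hm : n ∈ S <;> by_cases hm' : n + q ∈ S <;> simp_all
  have hsum : ∑ i ∈ Finset.range q,
      (S.indicator (1 : ℕ → ℕ) (n + i) + S.indicator (1 : ℕ → ℕ) (n + (i + 1))) ≤ q := by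
    simpa [Nat.add_assoc] using Finset.sum_le_card_nsmul (Finset.range q) _ 1 fun i _ => hone (n + i)
  rw [Finset.sum_add_distrib] at hsum
  have hr := Finset.sum_range_succ (fun i => S.indicator (1 : ℕ → ℕ) (n + i)) q
  have hl := Finset.sum_range_succ' (fun i => S.indicator (1 : ℕ → ℕ) (n + i)) q
  simp only [Nat.add_zero] at hl
  obtain ⟨r, rfl⟩ := hqe
  omega

lemma two_mul_sum_range_mul_le {f : ℕ → ℕ} {m q : ℕ}
    (h : ∀ n, 2 * ∑ i ∈ Finset.range m, f (n + i) ≤ q) (k : ℕ) :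
    2 * ∑ i ∈ Finset.range (m * k), f i ≤ k * q := by
  induction k with
  | zero => simp
  | succ k ih =>
    rw [Nat.mul_succ, Finset.sum_range_add, Nat.mul_add, Nat.succ_mul k]
    exact Nat.add_le_add ih (h _)

lemma countBelow_eq_sum (S : Set ℕ) (x : ℕ) :
    countBelow S x = ∑ i ∈ Finset.range (x + 1), S.indicator (1 : ℕ → ℕ) i := by
  classical
  have : S ∩ Set.Iic x = ((Finset.range (x + 1)).filter (· ∈ S) : Finset ℕ) := by
    ext i
    simp [and_comm]
  rw [countBelow, this, Set.ncard_coe_finset, Finset.card_filter]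
  simp [Set.indicator_apply]

lemma upperDensity_le_of_countBelow_le {S : Set ℕ} {c C : ℝ}
    (h : ∀ x, (countBelow S x : ℝ) ≤ c * x + C) : upperDensity S ≤ c := by
  have ht : Tendsto (fun x : ℕ => c + C / (x : ℝ)) atTop (nhds c) := by
    simpa using tendsto_const_nhds.add (tendsto_const_div_atTop_nhds_zero_nat C)
  rw [upperDensity, ← ht.limsup_eq]
  refine Filter.limsup_le_limsup ?_ ?_ ht.isBoundedUnder_le
  · filter_upwards [eventually_gt_atTop 0] with x hx
    have hx' : (0 : ℝ) < x := by exact_mod_cast hx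
    rw [div_le_iff₀ hx', add_mul, div_mul_cancel₀ _ hx'.ne']
    exact h x
  · exact Filter.IsBoundedUnder.isCoboundedUnder_le
      (isBoundedUnder_of ⟨0, fun x => by positivity⟩)

/-- If `1 ∈ M` and `q ∈ M` with `q > 1` even, then `μ(M) ≤ q/(2(q+1))`. -/
theorem stmt12 (M : Set ℕ) (hpos : ∀ k ∈ M, 0 < k)
    (h1 : 1 ∈ M) (q : ℕ) (hq : 1 < q) (hqM : q ∈ M) (hqe : Even q) :
    muM M ≤ (q : ℝ) / (2 * ((q : ℝ) + 1)) := by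
  refine Real.sSup_le ?_ (by positivity)
  rintro _ ⟨S, hS, rfl⟩
  refine upperDensity_le_of_countBelow_le (C := q) fun x => ?_
  have havoid : ∀ d ∈ M, ∀ n ∈ S, n + d ∉ S := fun d hd n hn hn' =>
    hS _ hn' _ hn (by simpa using hd)
  have hblock := two_mul_sum_range_mul_le
    (two_mul_sum_indicator_le hqe (havoid 1 h1) (havoid q hqM)) (x / (q + 1) + 1)
  have hcount : countBelow S x ≤ ∑ i ∈ Finset.range ((q + 1) * (x / (q + 1) + 1)),
      S.indicator (1 : ℕ → ℕ) i := by
    rw [countBelow_eq_sum]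
    exact Finset.sum_le_sum_of_subset
      (Finset.range_mono (Nat.lt_mul_div_succ x (Nat.succ_pos q)))
  have hle : (2 : ℝ) * countBelow S x ≤ (((x / (q + 1) : ℕ) : ℝ) + 1) * q := by
    exact_mod_cast (Nat.mul_le_mul_left 2 hcount).trans hblock
  have hdiv : ((x / (q + 1) : ℕ) : ℝ) ≤ x / ((q : ℝ) + 1) := by
    simpa using Nat.cast_div_le (α := ℝ) (m := x) (n := q + 1)
  have hmul := mul_le_mul_of_nonneg_right hdiv q.cast_nonneg
  have heq : (q : ℝ) / (2 * ((q : ℝ) + 1)) * x = x / ((q : ℝ) + 1) * q / 2 := by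
    field_simp
  have hq0 : (0 : ℝ) ≤ q := q.cast_nonneg
  rw [heq]
  linarith
end

section
/- Let M = {m₁, m₂, m₃, …} be a (finite or infinite) set of positive integers, and let c and m be positive integers with gcd(c, m) = 1. Put d = min_k |c·m_k|_m, where |x|_m denotes the absolute value of the absolutely least remainder of x modulo m (i.e., the distance from x to the nearest multiple of m). Then μ(M) ≥ d/m. -/
open Filter Set Pointwise

theorem countBelow_le (S : Set ℕ) (x : ℕ) : countBelow S x ≤ x + 1 := by
  have h := Set.ncard_le_ncard (Set.inter_subset_right : S ∩ Set.Iic x ⊆ Set.Iic x)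
    (Set.finite_Iic x)
  have h' : (Set.Iic x).ncard = x + 1 := by
    rw [← Finset.coe_Iic, Set.ncard_coe_finset, Nat.card_Iic]
  exact h.trans h'.le

theorem isBoundedUnder_countBelow_div (S : Set ℕ) :
    IsBoundedUnder (· ≤ ·) atTop (fun x : ℕ => (countBelow S x : ℝ) / x) :=
  isBoundedUnder_of ⟨2, countBelow_div_le_two S⟩

/-- The integers `n` for which `c * n` has residue less than `d` modulo `m` form an `M`-set as
soon as `c * k` is at distance at least `d` from the multiples of `m` for all `k ∈ M`. -/
theorem isMSet_setOf_mul_mod_lt {M : Set ℕ} (hpos : ∀ k ∈ M, 0 < k) {c m d : ℕ}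
    (hd : ∀ k ∈ M, d ≤ min ((c * k) % m) (m - (c * k) % m)) :
    IsMSet M {n | (c * n) % m < d} := by
  intro a ha b hb hab
  simp only [Set.mem_ofPred_eq] at ha hb
  have hk := hd _ hab
  have hba : a = b + (a - b) := by have := hpos _ hab; omega
  have hr := le_min_iff.1 hk
  have hmod : (c * a) % m = (c * b) % m + (c * (a - b)) % m := by
    conv_lhs => rw [hba, mul_add, Nat.add_mod]
    exact Nat.mod_eq_of_lt (by omega)
  omega

theorem mul_le_countBelow {c m d : ℕ} (hm : 0 < m) (hgcd : Nat.Coprime c m) (hdm : d ≤ m)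
    (Q : ℕ) : Q * d ≤ countBelow {n | (c * n) % m < d} (Q * m) := by
  obtain ⟨u, hu⟩ : ∃ u, c * u ≡ 1 [MOD m] := by
    rcases Nat.lt_or_ge 1 m with h | h
    · obtain ⟨u, -, hu⟩ := Nat.exists_mul_mod_eq_one_of_coprime hgcd h
      exact ⟨u, by rw [Nat.ModEq, hu, Nat.mod_eq_of_lt h]⟩
    · obtain rfl : m = 1 := by omega
      exact ⟨0, Nat.modEq_one⟩
  set f : ℕ × ℕ → ℕ := fun p => p.1 * m + (u * p.2) % m with hf
  have hdiv : ∀ p, f p / m = p.1 := fun p => by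
    simp only [hf]
    rw [Nat.mul_comm, Nat.mul_add_div hm, Nat.div_eq_of_lt (Nat.mod_lt _ hm), add_zero]
  have hmod : ∀ p : ℕ × ℕ, p.2 < d → (c * f p) % m = p.2 := fun p hp => by
    have h1 : f p ≡ u * p.2 [MOD m] := by simp [hf, Nat.ModEq]
    have h2 : c * f p ≡ p.2 [MOD m] := by
      calc c * f p ≡ c * (u * p.2) [MOD m] := h1.mul_left c
        _ = c * u * p.2 := (mul_assoc _ _ _).symm
        _ ≡ 1 * p.2 [MOD m] := hu.mul_right _
        _ = p.2 := one_mul _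
    rw [h2, Nat.mod_eq_of_lt (hp.trans_le hdm)]
  have hinj : Set.InjOn f (Finset.range Q ×ˢ Finset.range d : Finset (ℕ × ℕ)) := by
    intro p hp q hq hpq
    simp only [Finset.coe_product, Finset.coe_range, Set.mem_prod, Set.mem_Iio] at hp hq
    exact Prod.ext (by rw [← hdiv p, hpq, hdiv]) (by rw [← hmod p hp.2, hpq, hmod q hq.2])
  have hcard := hinj.ncard_image
  rw [Set.ncard_coe_finset, Finset.card_product, Finset.card_range, Finset.card_range] at hcard
  rw [← hcard]
  refine Set.ncard_le_ncard ?_ ((Set.finite_Iic _).subset Set.inter_subset_right)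
  rintro _ ⟨p, hp, rfl⟩
  simp only [Finset.coe_product, Finset.coe_range, Set.mem_prod, Set.mem_Iio] at hp
  refine ⟨by simpa only [Set.mem_ofPred_eq, hmod p hp.2] using hp.2, ?_⟩
  calc f p ≤ p.1 * m + m := Nat.add_le_add_left (Nat.mod_lt _ hm).le _
    _ = (p.1 + 1) * m := by ring
    _ ≤ Q * m := Nat.mul_le_mul_right _ hp.1

theorem div_le_upperDensity_s13 {c m d : ℕ} (hm : 0 < m) (hgcd : Nat.Coprime c m) (hdm : d ≤ m) :
    (d : ℝ) / m ≤ upperDensity {n | (c * n) % m < d} := by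
  refine le_limsup_of_frequently_le (frequently_atTop.2 fun N => ?_)
    (isBoundedUnder_countBelow_div _)
  refine ⟨(N + 1) * m, by nlinarith, ?_⟩
  have h : (((N + 1) * d : ℕ) : ℝ) ≤ countBelow {n | (c * n) % m < d} ((N + 1) * m) := by
    exact_mod_cast mul_le_countBelow hm hgcd hdm (N + 1)
  have hm' : (0 : ℝ) < m := by exact_mod_cast hm
  have hN : (0 : ℝ) < N + 1 := by positivity
  rw [div_le_div_iff₀ hm' (by push_cast; positivity)]
  push_cast at h ⊢
  nlinarith

/-- Lemma 1 (Cantor–Gordon): Let `M` be a nonempty set of positive integers, and let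
`c, m` be positive integers with `gcd(c, m) = 1`. If
`d = min_{k ∈ M} |c·k|_m` (the distance from `c·k` to the nearest multiple of `m`),
then `μ(M) ≥ d/m`. -/
theorem stmt13 (M : Set ℕ) (hpos : ∀ k ∈ M, 0 < k) (hne : M.Nonempty)
    (c m : ℕ) (hc : 0 < c) (hm : 0 < m) (hgcd : Nat.gcd c m = 1)
    (d : ℕ) (hd : d = sInf {v | ∃ k ∈ M, v = min ((c * k) % m) (m - (c * k) % m)}) :
    (d : ℝ) / (m : ℝ) ≤ muM M := by
  have hle : ∀ k ∈ M, d ≤ min ((c * k) % m) (m - (c * k) % m) := fun k hk =>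
    hd ▸ Nat.sInf_le ⟨k, hk, rfl⟩
  obtain ⟨k, hk⟩ := hne
  have hdm : d ≤ m := (le_min_iff.1 (hle k hk)).1.trans (Nat.mod_lt _ hm).le
  exact (div_le_upperDensity_s13 hm hgcd hdm).trans
    (upperDensity_le_muM (isMSet_setOf_mul_mod_lt hpos hle))
end
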